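/- Let k ≥ 1 and t > 0. Then for every function f : (ℝ^n)^{k+1} → ℝ one has, pointwise on (ℝ^n)^{k+1}: b(η_{k,k+1,t} f) + η_{k−1,k+1,t}(b f) = (−1)^k Ψ_{k,k,t}·f + Ψ_{k,k,t}·Σ_{j=0}^{k−1} (−1)^j s_{k−1,k−1}(b_j f) + (−1)^{k+1} Ψ_{k,t}·f, where η_{k−1,k+1,t} := 0. -/

import Mathlib

open scoped BigOperators
open MeasureTheory

noncomputable section

abbrev Euc (n : ℕ) : Type := EuclideanSpace ℝ (Fin n)

/-- The `i`-th simplicial face map `D_i : E^k → E^{k+1}`. -/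
def face {n : ℕ} (k i : ℕ) (x : Fin k → Euc n) : Fin (k + 1) → Euc n :=
  fun l =>
    if _hle : (l : ℕ) ≤ i then
      if h : (l : ℕ) < k then x ⟨l, h⟩
      else if h0 : 0 < k then x ⟨0, h0⟩ else 0
    else x ⟨(l : ℕ) - 1, by have hl := l.isLt; omega⟩

/-- The Hochschild boundary `b f = ∑ (-1)^i f ∘ D_i`. -/
def hb {n k : ℕ} (f : (Fin (k + 1) → Euc n) → ℝ) : (Fin k → Euc n) → ℝ :=
  fun x => ∑ i ∈ Finset.range (k + 1), (-1 : ℝ) ^ i * f (face k i x)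

/-- Degeneracy `σ_i` omitting the `(i+1)`-st entry. -/
def degen {n : ℕ} (i : ℕ) {m : ℕ} (x : Fin (m + 1) → Euc n) : Fin m → Euc n :=
  fun l =>
    if (l : ℕ) ≤ i then x ⟨l, by have hl := l.isLt; omega⟩
    else x ⟨(l : ℕ) + 1, by have hl := l.isLt; omega⟩

/-- Squared distance of cyclically consecutive entries. -/
def dsq {n m : ℕ} (x : Fin m → Euc n) (j : ℕ) : ℝ :=
  if hm : 0 < m then
    ‖x ⟨j % m, Nat.mod_lt _ hm⟩ - x ⟨(j + 1) % m, Nat.mod_lt _ hm⟩‖ ^ 2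
  else 0

/-- Cutoff `Ψ` with `i` factors on `E^m`. -/
def Psi {n : ℕ} (ρ : ℝ → ℝ) (i : ℕ) (t : ℝ) {m : ℕ} (x : Fin m → Euc n) : ℝ :=
  ∏ j ∈ Finset.range i, ρ (dsq x j / t)

/-- `η_{m,i,t} g = Ψ_{m+1,i,t} · (g ∘ σ_{i-1})`. -/
def eta {n : ℕ} (ρ : ℝ → ℝ) (i : ℕ) (t : ℝ) {m : ℕ} (g : (Fin m → Euc n) → ℝ) :
    (Fin (m + 1) → Euc n) → ℝ :=
  fun x => Psi ρ i t x * g (degen (i - 1) x)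

/-- `H_{m,t} = ∑_{i=1}^{m+1} (-1)^{i+1} η_{m,i,t}`. -/
def Hmap {n : ℕ} (ρ : ℝ → ℝ) (t : ℝ) {m : ℕ} (g : (Fin m → Euc n) → ℝ) :
    (Fin (m + 1) → Euc n) → ℝ :=
  fun x => ∑ i ∈ Finset.Icc 1 m, (-1 : ℝ) ^ (i + 1) * eta ρ i t g x

/-- `K_{m,t} g = ∫_t^1 H_{m,s/2}(∂_s Ψ_{m,s} · g) ds`. -/
def Kmap {n : ℕ} (ρ : ℝ → ℝ) (t : ℝ) {m : ℕ} (g : (Fin m → Euc n) → ℝ) :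
    (Fin (m + 1) → Euc n) → ℝ :=
  fun x => ∫ s in t..(1 : ℝ), Hmap ρ (s / 2) (fun y => deriv (fun u => Psi ρ m u y) s * g y) x

/-- Standard basis vector in the `j`-th block, `l`-th coordinate. -/
def blockVec (n m j : ℕ) (l : Fin n) : Fin m → Euc n :=
  fun j' => if (j' : ℕ) = j then EuclideanSpace.single l 1 else 0

/-- Iterated partial derivative `∂^α_j`. -/
def mpderiv {n m : ℕ} (j : ℕ) (α : Fin n → ℕ) (g : (Fin m → Euc n) → ℝ) :
    (Fin m → Euc n) → ℝ :=
  (List.finRange n).foldr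
    (fun l gg => (fun h (x : Fin m → Euc n) => fderiv ℝ h x (blockVec n m j l))^[α l] gg) g


theorem dsq_of_lt {n m : ℕ} (y : Fin m → Euc n) {j : ℕ} (hj : j + 1 < m) :
    dsq y j = ‖y ⟨j, by omega⟩ - y ⟨j + 1, hj⟩‖ ^ 2 := by
  simp only [dsq, Nat.mod_eq_of_lt hj, Nat.mod_eq_of_lt (Nat.lt_of_succ_lt hj),
    Nat.zero_lt_of_lt hj, dite_true]

theorem dsq_last {n m : ℕ} (y : Fin (m + 1) → Euc n) :
    dsq y m = ‖y ⟨m, by omega⟩ - y ⟨0, by omega⟩‖ ^ 2 := by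
  simp [dsq]

/-- A face repeats the entry `i`, so the squared distance at `i` vanishes. -/
theorem dsq_face_self {n m i : ℕ} (x : Fin m → Euc n) (hi : i < m) :
    dsq (face m i x) i = 0 := by
  rw [dsq_of_lt _ (by omega)]
  simp [face, hi]

theorem dsq_face_of_lt {n m i j : ℕ} (x : Fin m → Euc n) (hji : j < i) (hjm : j + 1 < m) :
    dsq (face m i x) j = dsq x j := by
  rw [dsq_of_lt _ (by omega), dsq_of_lt _ hjm]
  simp [face, hji.le, Nat.succ_le_of_lt hji, hjm, Nat.lt_of_succ_lt hjm]

theorem dsq_face_succ_of_le {n m i j : ℕ} (x : Fin m → Euc n) (hij : i ≤ j) (hjm : j + 1 < m) :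
    dsq (face m i x) (j + 1) = dsq x j := by
  rw [dsq_of_lt _ (by omega), dsq_of_lt _ hjm]
  simp [face, show ¬ j + 1 ≤ i by omega, show ¬ j + 1 + 1 ≤ i by omega]

theorem dsq_face_last {n m : ℕ} (x : Fin (m + 1) → Euc n) :
    dsq (face (m + 1) (m + 1) x) m = dsq x m := by
  rw [dsq_of_lt _ (by omega), dsq_last]
  simp [face]

theorem Psi_face {n k i : ℕ} {ρ : ℝ → ℝ} (hρ : ρ 0 = 1) (t : ℝ) (hi : i ≤ k)
    (x : Fin (k + 1) → Euc n) :
    Psi ρ (k + 1) t (face (k + 1) i x) = Psi ρ k t x := by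
  obtain ⟨r, rfl⟩ := Nat.exists_eq_add_of_le hi
  simp only [Psi]
  rw [show Finset.range (i + r + 1) = Finset.range (i + (r + 1)) from rfl,
    Finset.prod_range_add, Finset.prod_range_succ', Finset.prod_range_add _ i r,
    add_zero, dsq_face_self x (by omega), zero_div, hρ, mul_one]
  congr 1
  · refine Finset.prod_congr rfl fun j hj => ?_
    have := Finset.mem_range.mp hj
    rw [dsq_face_of_lt x this (by omega)]
  · refine Finset.prod_congr rfl fun j hj => ?_
    have := Finset.mem_range.mp hj
    rw [← add_assoc, dsq_face_succ_of_le x (by omega) (by omega)]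

theorem Psi_face_last {n k : ℕ} (ρ : ℝ → ℝ) (t : ℝ) (x : Fin (k + 1) → Euc n) :
    Psi ρ (k + 1) t (face (k + 1) (k + 1) x) = Psi ρ (k + 1) t x := by
  simp only [Psi, Finset.prod_range_succ, dsq_face_last]
  congr 1
  refine Finset.prod_congr rfl fun j hj => ?_
  have := Finset.mem_range.mp hj
  rw [dsq_face_of_lt x (by omega) (by omega)]

theorem degen_face_of_le {n k i : ℕ} (x : Fin (k + 1) → Euc n) (hi : k ≤ i) :
    degen k (face (k + 1) i x) = x := by
  funext l
  have hl := l.isLt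
  simp [degen, face, show (l : ℕ) ≤ k by omega, show (l : ℕ) ≤ i by omega]

theorem degen_face_of_lt {n k i : ℕ} (x : Fin (k + 1) → Euc n) (hi : i < k) :
    degen k (face (k + 1) i x) = face k i (degen (k - 1) x) := by
  funext l
  have hl := l.isLt
  by_cases h : (l : ℕ) ≤ i
  · simp [degen, face, h, show (l : ℕ) ≤ k by omega, show (l : ℕ) < k by omega,
      show (l : ℕ) ≤ k - 1 by omega]
  · simp [degen, face, h, show (l : ℕ) ≤ k by omega, show (l : ℕ) - 1 ≤ k - 1 by omega]

theorem stmt13 {n : ℕ} (hn : 1 ≤ n)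
    (ρ : ℝ → ℝ) (hρsmooth : ContDiff ℝ (⊤ : ℕ∞) ρ)
    (hρ0 : ∀ r : ℝ, 0 ≤ ρ r) (hρ1 : ∀ r : ℝ, ρ r ≤ 1)
    (hρone : ∀ r : ℝ, r ≤ 1 / 3 → ρ r = 1) (hρzero : ∀ r : ℝ, 1 / 2 < r → ρ r = 0)
    {k : ℕ} (hk : 1 ≤ k) (t : ℝ) (ht : 0 < t)
    (f : (Fin (k + 1) → Euc n) → ℝ) (x : Fin (k + 1) → Euc n) :
    hb (eta ρ (k + 1) t f) x + 0
      = (-1 : ℝ) ^ k * (Psi ρ k t x * f x)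
        + Psi ρ k t x *
            ∑ j ∈ Finset.range k, (-1 : ℝ) ^ j * f (face k j (degen (k - 1) x))
        + (-1 : ℝ) ^ (k + 1) * (Psi ρ (k + 1) t x * f x) := by
  have hρ : ρ 0 = 1 := hρone 0 (by norm_num)
  have hsum : ∑ i ∈ Finset.range k, (-1 : ℝ) ^ i * eta ρ (k + 1) t f (face (k + 1) i x)
      = Psi ρ k t x * ∑ j ∈ Finset.range k, (-1 : ℝ) ^ j * f (face k j (degen (k - 1) x)) := by
    rw [Finset.mul_sum]
    refine Finset.sum_congr rfl fun i hi => ?_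
    have hik := Finset.mem_range.mp hi
    rw [eta, Psi_face hρ t hik.le, Nat.add_sub_cancel, degen_face_of_lt x hik]
    ring
  rw [hb, Finset.sum_range_succ, Finset.sum_range_succ, hsum]
  simp only [eta, Nat.add_sub_cancel, Psi_face hρ t le_rfl, Psi_face_last,
    degen_face_of_le x le_rfl, degen_face_of_le x (Nat.le_succ k)]
  ring
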